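/- For every k ≥ 2 and every execution of average-link on a finite metric space with n points (all points distinct), the k-clustering A^k satisfies max-diam(A^k) ≤ 2·H_n · sep_min(A^k), i.e., cs-ratio_DM(A^k) ≤ 2·H_n. -/

import Mathlib

open Finset

/-- Average distance between two finite sets of points. -/
noncomputable def avgD {X : Type*} (d : X → X → ℝ) (A B : Finset X) : ℝ :=
  (∑ a ∈ A, ∑ b ∈ B, d a b) / ((A.card : ℝ) * (B.card : ℝ))

/-- The diameter of a finite set. -/
noncomputable def diamF {X : Type*} (d : X → X → ℝ) (C : Finset X) : ℝ :=
  sSup {r : ℝ | ∃ x ∈ C, ∃ y ∈ C, r = d x y}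

/-- `sep_min(𝒞) = min_{A ≠ B ∈ 𝒞} avg(A,B)`. -/
noncomputable def sepMin {X : Type*} (d : X → X → ℝ) (𝒞 : Finset (Finset X)) : ℝ :=
  sInf {r : ℝ | ∃ A ∈ 𝒞, ∃ B ∈ 𝒞, A ≠ B ∧ r = avgD d A B}

/-- `max-diam(𝒞) = max_{C ∈ 𝒞} diam(C)`. -/
noncomputable def maxDiam {X : Type*} (d : X → X → ℝ) (𝒞 : Finset (Finset X)) : ℝ :=
  sSup {r : ℝ | ∃ C ∈ 𝒞, r = diamF d C}

/-- The `p`-th harmonic number `H_p = Σ_{i=1}^p 1/i`. -/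
noncomputable def harmonicR (p : ℕ) : ℝ := ∑ i ∈ Finset.range p, (1 : ℝ) / (i + 1)

/-- An execution of average-link. -/
structure AvgLinkExec (X : Type*) [Fintype X] [DecidableEq X] (d : X → X → ℝ) where
  part : ℕ → Finset (Finset X)
  init : part (Fintype.card X) = Finset.univ.image (fun x : X => ({x} : Finset X))
  merge : ∀ k : ℕ, 1 ≤ k → k < Fintype.card X →
    ∃ A ∈ part (k + 1), ∃ B ∈ part (k + 1), A ≠ B ∧
      (∀ A' ∈ part (k + 1), ∀ B' ∈ part (k + 1), A' ≠ B' → avgD d A B ≤ avgD d A' B') ∧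
      part k = insert (A ∪ B) (((part (k + 1)).erase A).erase B)

lemma harmonicR_nonneg (p : ℕ) : 0 ≤ harmonicR p :=
  Finset.sum_nonneg fun i _ => by positivity

lemma harmonicR_mono {p q : ℕ} (h : p ≤ q) : harmonicR p ≤ harmonicR q :=
  Finset.sum_le_sum_of_subset_of_nonneg (by simpa using h) fun i _ _ => by positivity

lemma harmonicR_add_div_le (a b : ℕ) :
    harmonicR a + (b : ℝ) / (a + b) ≤ harmonicR (a + b) := by
  unfold harmonicR
  rw [Finset.sum_range_add]
  gcongr
  calc (b : ℝ) / (a + b) = ∑ _i ∈ Finset.range b, (1 : ℝ) / (a + b) := by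
        rw [Finset.sum_const, Finset.card_range, nsmul_eq_mul]; ring
    _ ≤ _ := by
        refine Finset.sum_le_sum fun i hi => ?_
        have hib : (i : ℝ) + 1 ≤ b := by exact_mod_cast Finset.mem_range.1 hi
        push_cast
        exact one_div_le_one_div_of_le (by positivity) (by linarith)

section AvgLink

variable {X : Type*}

lemma avgD_mul_card (d : X → X → ℝ) {A B : Finset X} (hA : A.Nonempty) (hB : B.Nonempty) :
    ∑ a ∈ A, ∑ b ∈ B, d a b = avgD d A B * ((A.card : ℝ) * B.card) := by
  have hA' : (A.card : ℝ) ≠ 0 := by exact_mod_cast hA.card_ne_zero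
  have hB' : (B.card : ℝ) ≠ 0 := by exact_mod_cast hB.card_ne_zero
  rw [avgD, div_mul_cancel₀ _ (mul_ne_zero hA' hB')]

lemma le_avgD_iff (d : X → X → ℝ) {A B : Finset X} (hA : A.Nonempty) (hB : B.Nonempty)
    (m : ℝ) : m ≤ avgD d A B ↔ m * ((A.card : ℝ) * B.card) ≤ ∑ a ∈ A, ∑ b ∈ B, d a b := by
  have hA' : (0 : ℝ) < A.card := by exact_mod_cast hA.card_pos
  have hB' : (0 : ℝ) < B.card := by exact_mod_cast hB.card_pos
  rw [avgD, le_div_iff₀ (mul_pos hA' hB')]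

lemma avgD_comm [PseudoMetricSpace X] (A B : Finset X) :
    avgD dist A B = avgD dist B A := by
  unfold avgD
  rw [Finset.sum_comm, mul_comm]
  simp only [dist_comm]

lemma avgD_nonneg [PseudoMetricSpace X] (A B : Finset X) : 0 ≤ avgD dist A B :=
  div_nonneg (Finset.sum_nonneg fun _ _ => Finset.sum_nonneg fun _ _ => dist_nonneg)
    (by positivity)

/-- Merging two clusters does not bring them closer to a third one. -/
lemma le_avgD_union [DecidableEq X] (d : X → X → ℝ) {A B C : Finset X} (hA : A.Nonempty)
    (hB : B.Nonempty) (hC : C.Nonempty) (hAB : Disjoint A B) {m : ℝ}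
    (hAC : m ≤ avgD d A C) (hBC : m ≤ avgD d B C) : m ≤ avgD d (A ∪ B) C := by
  rw [le_avgD_iff d hA hC] at hAC
  rw [le_avgD_iff d hB hC] at hBC
  rw [le_avgD_iff d (hA.mono Finset.subset_union_left) hC, Finset.sum_union hAB,
    Finset.card_union_of_disjoint hAB]
  push_cast
  linarith

/-- The triangle inequality `avg({x}, B) ≤ avg({x}, A) + avg(A, B)`, with denominators cleared. -/
lemma card_mul_sum_dist_le [PseudoMetricSpace X] (A B : Finset X) (x : X) :
    (A.card : ℝ) * ∑ b ∈ B, dist x b ≤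
      (B.card : ℝ) * ∑ a ∈ A, dist x a + ∑ a ∈ A, ∑ b ∈ B, dist a b := by
  calc (A.card : ℝ) * ∑ b ∈ B, dist x b = ∑ _a ∈ A, ∑ b ∈ B, dist x b := by
        rw [Finset.sum_const, nsmul_eq_mul]
    _ ≤ ∑ a ∈ A, ∑ b ∈ B, (dist x a + dist a b) :=
        Finset.sum_le_sum fun a _ => Finset.sum_le_sum fun b _ => dist_triangle _ _ _
    _ = _ := by
        simp only [Finset.sum_add_distrib, Finset.sum_const, nsmul_eq_mul, Finset.mul_sum]

/-- Merging `A` with `B` raises the average distance from `x` by at most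
`avg(A, B) · |B| / (|A| + |B|)`, which the harmonic numbers absorb. -/
lemma sum_dist_union_le [PseudoMetricSpace X] [DecidableEq X] {A B : Finset X}
    (hA : A.Nonempty) (hB : B.Nonempty) (hAB : Disjoint A B) {x : X}
    (hx : ∑ y ∈ A, dist x y ≤ A.card * harmonicR A.card * avgD dist A B) :
    ∑ y ∈ A ∪ B, dist x y ≤
      (A ∪ B).card * harmonicR (A ∪ B).card * avgD dist A B := by
  have htri := card_mul_sum_dist_le A B x
  rw [avgD_mul_card dist hA hB] at htri
  have hH := harmonicR_add_div_le A.card B.card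
  have hm := avgD_nonneg A B
  rw [Finset.sum_union hAB, Finset.card_union_of_disjoint hAB]
  have ha : (0 : ℝ) < A.card := by exact_mod_cast hA.card_pos
  have hb : (0 : ℝ) < B.card := by exact_mod_cast hB.card_pos
  push_cast
  generalize avgD dist A B = m at *
  generalize harmonicR (A.card + B.card) = H' at *
  generalize harmonicR A.card = H at *
  generalize (A.card : ℝ) = a at *
  generalize (B.card : ℝ) = b at *
  generalize ∑ y ∈ A, dist x y = F at *
  generalize ∑ y ∈ B, dist x y = G at *
  have hG : G ≤ b * H * m + b * m := by
    refine le_of_mul_le_mul_left ?_ ha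
    have := mul_le_mul_of_nonneg_left hx hb.le
    linarith
  have hH2 : (a + b) * H + b ≤ (a + b) * H' := by
    have := mul_le_mul_of_nonneg_left hH (add_pos ha hb).le
    rwa [mul_add, mul_div_cancel₀ _ (add_pos ha hb).ne'] at this
  have := mul_le_mul_of_nonneg_right hH2 hm
  linarith

/-- The properties of a `k`-clustering preserved by average-link steps: it consists of `k`
disjoint nonempty clusters at mutual average distance at least `m`, and the average distance from
a point to its own cluster `C` is at most `H_{|C|} · m`. -/
structure IsHarmonicClustering [PseudoMetricSpace X] (𝒞 : Finset (Finset X)) (k : ℕ)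
    (m : ℝ) : Prop where
  card_eq : 𝒞.card = k
  nonempty : ∀ C ∈ 𝒞, C.Nonempty
  disjoint : ∀ A ∈ 𝒞, ∀ B ∈ 𝒞, A ≠ B → Disjoint A B
  nonneg : 0 ≤ m
  le_avgD : ∀ A ∈ 𝒞, ∀ B ∈ 𝒞, A ≠ B → m ≤ avgD dist A B
  sum_dist_le : ∀ C ∈ 𝒞, ∀ x ∈ C, ∑ y ∈ C, dist x y ≤ C.card * harmonicR C.card * m

lemma isHarmonicClustering_singletons [PseudoMetricSpace X] [Fintype X] [DecidableEq X] :
    IsHarmonicClustering (Finset.univ.image fun x : X => ({x} : Finset X))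
      (Fintype.card X) 0 where
  card_eq := Finset.card_image_of_injective _ Finset.singleton_injective
  nonempty := by simp
  disjoint := by simp [eq_comm]
  nonneg := le_rfl
  le_avgD _ _ _ _ _ := avgD_nonneg _ _
  sum_dist_le := by simp

lemma IsHarmonicClustering.merge [PseudoMetricSpace X] [DecidableEq X]
    {𝒞 : Finset (Finset X)} {k : ℕ} {m : ℝ} (h : IsHarmonicClustering 𝒞 (k + 1) m)
    {A B : Finset X} (hA : A ∈ 𝒞) (hB : B ∈ 𝒞) (hne : A ≠ B)
    (hmin : ∀ A' ∈ 𝒞, ∀ B' ∈ 𝒞, A' ≠ B' → avgD dist A B ≤ avgD dist A' B') :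
    IsHarmonicClustering (insert (A ∪ B) ((𝒞.erase A).erase B)) k (avgD dist A B) := by
  have hAn := h.nonempty A hA
  have hBn := h.nonempty B hB
  have hAB := h.disjoint A hA B hB hne
  have hm := h.le_avgD A hA B hB hne
  have hdisj : ∀ C ∈ (𝒞.erase A).erase B, Disjoint (A ∪ B) C := by
    intro C hC
    simp only [Finset.mem_erase] at hC
    exact Finset.disjoint_union_left.2
      ⟨h.disjoint A hA C hC.2.2 (Ne.symm hC.2.1), h.disjoint B hB C hC.2.2 (Ne.symm hC.1)⟩
  have havg : ∀ C ∈ (𝒞.erase A).erase B, avgD dist A B ≤ avgD dist (A ∪ B) C := by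
    intro C hC
    simp only [Finset.mem_erase] at hC
    exact le_avgD_union dist hAn hBn (h.nonempty C hC.2.2) hAB
      (hmin A hA C hC.2.2 (Ne.symm hC.2.1)) (hmin B hB C hC.2.2 (Ne.symm hC.1))
  have hsub : ∀ C ∈ (𝒞.erase A).erase B, C ∈ 𝒞 := fun C hC =>
    Finset.mem_of_mem_erase (Finset.mem_of_mem_erase hC)
  have hUn : (A ∪ B).Nonempty := hAn.mono Finset.subset_union_left
  have hold : ∀ C ∈ 𝒞, ∀ x ∈ C,
      ∑ y ∈ C, dist x y ≤ C.card * harmonicR C.card * avgD dist A B := fun C hC x hx =>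
    (h.sum_dist_le C hC x hx).trans
      (mul_le_mul_of_nonneg_left hm (mul_nonneg (Nat.cast_nonneg _) (harmonicR_nonneg _)))
  refine ⟨?_, ?_, ?_, h.nonneg.trans hm, ?_, ?_⟩
  · have hnot : A ∪ B ∉ (𝒞.erase A).erase B := fun hC =>
      hUn.ne_empty (disjoint_self.1 (hdisj _ hC))
    have hcard := Finset.card_erase_of_mem hA
    rw [Finset.card_insert_of_notMem hnot,
      Finset.card_erase_of_mem (Finset.mem_erase.2 ⟨hne.symm, hB⟩), hcard, h.card_eq]
    have : 1 < 𝒞.card := Finset.one_lt_card.2 ⟨A, hA, B, hB, hne⟩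
    rw [h.card_eq] at this
    omega
  · intro C hC
    rcases Finset.mem_insert.1 hC with rfl | hC
    · exact hUn
    · exact h.nonempty C (hsub C hC)
  · intro C hC D hD hCD
    rcases Finset.mem_insert.1 hC with rfl | hC <;> rcases Finset.mem_insert.1 hD with rfl | hD
    · exact absurd rfl hCD
    · exact hdisj D hD
    · exact (hdisj C hC).symm
    · exact h.disjoint C (hsub C hC) D (hsub D hD) hCD
  · intro C hC D hD hCD
    rcases Finset.mem_insert.1 hC with rfl | hC <;> rcases Finset.mem_insert.1 hD with rfl | hD
    · exact absurd rfl hCD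
    · exact havg D hD
    · rw [avgD_comm C]
      exact havg C hC
    · exact hmin C (hsub C hC) D (hsub D hD) hCD
  · intro C hC x hx
    rcases Finset.mem_insert.1 hC with rfl | hC
    · rcases Finset.mem_union.1 hx with hx | hx
      · exact sum_dist_union_le hAn hBn hAB (hold A hA x hx)
      · rw [Finset.union_comm, avgD_comm A]
        exact sum_dist_union_le hBn hAn hAB.symm (avgD_comm A B ▸ hold B hB x hx)
    · exact hold C (hsub C hC) x hx

lemma AvgLinkExec.exists_isHarmonicClustering [PseudoMetricSpace X] [Fintype X]
    [DecidableEq X] (E : AvgLinkExec X dist) {k : ℕ} (hk : 1 ≤ k)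
    (hkn : k ≤ Fintype.card X) : ∃ m, IsHarmonicClustering (E.part k) k m := by
  induction hkn using Nat.decreasingInduction with
  | self => exact ⟨0, E.init ▸ isHarmonicClustering_singletons⟩
  | of_succ k hkn ih =>
    obtain ⟨m, hm⟩ := ih (by omega)
    obtain ⟨A, hA, B, hB, hne, hmin, hpart⟩ := E.merge k hk hkn
    exact ⟨avgD dist A B, hpart ▸ hm.merge hA hB hne hmin⟩

lemma IsHarmonicClustering.dist_le [PseudoMetricSpace X] {𝒞 : Finset (Finset X)} {k : ℕ}
    {m : ℝ} (h : IsHarmonicClustering 𝒞 k m) {C : Finset X} (hC : C ∈ 𝒞) {x y : X}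
    (hx : x ∈ C) (hy : y ∈ C) : dist x y ≤ 2 * harmonicR C.card * m := by
  have hpos : (0 : ℝ) < C.card := by exact_mod_cast (h.nonempty C hC).card_pos
  refine le_of_mul_le_mul_left ?_ hpos
  calc (C.card : ℝ) * dist x y = ∑ _z ∈ C, dist x y := by
        rw [Finset.sum_const, nsmul_eq_mul]
    _ ≤ ∑ z ∈ C, (dist x z + dist y z) :=
        Finset.sum_le_sum fun z _ => dist_triangle_right x y z
    _ ≤ _ := by
        rw [Finset.sum_add_distrib]
        linarith [h.sum_dist_le C hC x hx, h.sum_dist_le C hC y hy]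

lemma IsHarmonicClustering.maxDiam_le [PseudoMetricSpace X] [Fintype X]
    {𝒞 : Finset (Finset X)} {k : ℕ} {m : ℝ} (h : IsHarmonicClustering 𝒞 k m) :
    maxDiam dist 𝒞 ≤ 2 * harmonicR (Fintype.card X) * m := by
  have hbound : 0 ≤ 2 * harmonicR (Fintype.card X) * m :=
    mul_nonneg (mul_nonneg zero_le_two (harmonicR_nonneg _)) h.nonneg
  refine Real.sSup_le ?_ hbound
  rintro _ ⟨C, hC, rfl⟩
  refine Real.sSup_le ?_ hbound
  rintro _ ⟨x, hx, y, hy, rfl⟩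
  refine (h.dist_le hC hx hy).trans (mul_le_mul_of_nonneg_right ?_ h.nonneg)
  linarith [harmonicR_mono (Finset.card_le_univ C)]

lemma IsHarmonicClustering.le_sepMin [PseudoMetricSpace X] {𝒞 : Finset (Finset X)} {k : ℕ}
    {m : ℝ} (h : IsHarmonicClustering 𝒞 k m) (hk : 2 ≤ k) : m ≤ sepMin dist 𝒞 := by
  obtain ⟨A, hA, B, hB, hne⟩ := Finset.one_lt_card.1 (h.card_eq.symm ▸ hk : 1 < 𝒞.card)
  refine le_csInf ⟨_, A, hA, B, hB, hne, rfl⟩ ?_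
  rintro _ ⟨C, hC, D, hD, hCD, rfl⟩
  exact h.le_avgD C hC D hD hCD

end AvgLink

/-- For every `k ≥ 2` and every execution of average-link on a finite metric space with
`n` points, the `k`-clustering `A^k` satisfies `max-diam(A^k) ≤ 2·H_n · sep_min(A^k)`,
i.e. `cs-ratio_DM(A^k) ≤ 2·H_n`. -/
theorem avgLink_csRatioDM_le_two_harmonic {X : Type*} [MetricSpace X] [Fintype X]
    [DecidableEq X] (E : AvgLinkExec X dist) (k : ℕ) (hk2 : 2 ≤ k)
    (hkn : k ≤ Fintype.card X) :
    maxDiam dist (E.part k) ≤ 2 * harmonicR (Fintype.card X) * sepMin dist (E.part k) ∧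
    maxDiam dist (E.part k) / sepMin dist (E.part k) ≤ 2 * harmonicR (Fintype.card X) := by
  obtain ⟨m, hm⟩ := E.exists_isHarmonicClustering (by omega) hkn
  have hH : 0 ≤ 2 * harmonicR (Fintype.card X) := mul_nonneg zero_le_two (harmonicR_nonneg _)
  have hsep := hm.le_sepMin hk2
  have hmain := hm.maxDiam_le.trans (mul_le_mul_of_nonneg_left hsep hH)
  exact ⟨hmain, div_le_of_le_mul₀ (hm.nonneg.trans hsep) hH hmain⟩
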